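/- Let N ≥ 2 be an integer and let α be a real number with (4−N)/2 < α < 2. Then the function Z₀(x) = (1 − |x|^{2−α})/(1 + |x|^{2−α})^{(N−2+α)/(2−α)} satisfies the linearized equation div(|x|^α ∇(div(|x|^α ∇Z₀)))(x) = (2**_α − 1) U_{1,α}(x)^{2**_α − 2} Z₀(x) at every point x ∈ ℝ^N \ {0}. -/

import Mathlib

open Real MeasureTheory Filter

noncomputable section

/-- Laplacian of a real-valued function on Euclidean space. -/
def lap {N : ℕ} (u : EuclideanSpace ℝ (Fin N) → ℝ) (x : EuclideanSpace ℝ (Fin N)) : ℝ :=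
  ∑ i : Fin N, fderiv ℝ (fun y => fderiv ℝ u y (EuclideanSpace.single i 1)) x
    (EuclideanSpace.single i 1)

/-- The weighted operator `div(|x|^α ∇u)(x) = |x|^α Δu(x) + α |x|^(α-2) (x · ∇u(x))`.
Note that `x · ∇u(x)` is the directional derivative of `u` at `x` along `x`. -/
def wOp {N : ℕ} (α : ℝ) (u : EuclideanSpace ℝ (Fin N) → ℝ) (x : EuclideanSpace ℝ (Fin N)) : ℝ :=
  ‖x‖ ^ α * lap u x + α * ‖x‖ ^ (α - 2) * fderiv ℝ u x x

/-- The constant `C_{N,α} = [(N−4+2α)(N−2+α)N(N+2−α)]^{(N−4+2α)/(8−4α)}`. -/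
def Cconst (N : ℕ) (α : ℝ) : ℝ :=
  (((N : ℝ) - 4 + 2*α) * ((N : ℝ) - 2 + α) * (N : ℝ) * ((N : ℝ) + 2 - α)) ^
    (((N : ℝ) - 4 + 2*α) / (8 - 4*α))

/-- The radial solution `U_{λ,α}(x) = C_{N,α} λ^{(N−4+2α)/2} (1+λ^{2−α}|x|^{2−α})^{−(N−4+2α)/(2−α)}`. -/
def Usol (N : ℕ) (α lam : ℝ) (x : EuclideanSpace ℝ (Fin N)) : ℝ :=
  Cconst N α * lam ^ (((N : ℝ) - 4 + 2*α)/2) *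
    (1 + lam ^ (2-α) * ‖x‖ ^ (2-α)) ^ (-(((N : ℝ) - 4 + 2*α)/(2-α)))

/-- The critical exponent `2**_α = 2N/(N-4+2α)`. -/
def pexp (N : ℕ) (α : ℝ) : ℝ := 2*(N : ℝ)/((N : ℝ) - 4 + 2*α)

/-- The constant `C(M) = (M−4)(M−2)M(M+2)(Γ(M/2)²/(2Γ(M)))^{4/M}`. -/
def CM (M : ℝ) : ℝ :=
  (M-4)*(M-2)*M*(M+2) * (Real.Gamma (M/2)^2 / (2*Real.Gamma M)) ^ ((4 : ℝ)/M)

/-- The sharp radial constant `S^{rad}_{N,α}`. -/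
def Srad (N : ℕ) (α : ℝ) : ℝ :=
  ((2-α)/2) ^ ((4 : ℝ) - (4-2*α)/(N : ℝ)) *
    (2 * Real.pi ^ ((N : ℝ)/2) / Real.Gamma ((N : ℝ)/2)) ^ ((4-2*α)/(N : ℝ)) *
    CM (2*(N : ℝ)/(2-α))

/-- Derivative of a real power of the Euclidean norm away from the origin. -/
theorem hasFDerivAt_norm_rpow_of_ne_zero {E : Type*} [NormedAddCommGroup E]
    [InnerProductSpace ℝ E] (p : ℝ) {x : E} (hx : x ≠ 0) :
    HasFDerivAt (fun y : E => ‖y‖ ^ p) ((p * ‖x‖ ^ (p - 2)) • innerSL ℝ x) x := by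
  have hpos : 0 < ‖x‖ := norm_pos_iff.2 hx
  have h := ((hasStrictFDerivAt_norm_sq x).hasFDerivAt).rpow_const (p := p / 2)
    (Or.inl (by positivity))
  have e : (fun y : E => ‖y‖ ^ p) = fun y => (‖y‖ ^ 2) ^ (p / 2) := by
    funext y
    rw [← Real.rpow_natCast, ← Real.rpow_mul (norm_nonneg y)]
    congr 1
    push_cast
    ring
  rw [e]
  convert h using 1
  rw [← Real.rpow_natCast, ← Real.rpow_mul (norm_nonneg x)]
  ext v
  have e2 : ((2 : ℕ) : ℝ) * (p / 2 - 1) = p - 2 := by push_cast; ring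
  rw [e2]
  simp
  ring

/-- The weighted operator in the radial variable `s = |x|^(2-α)`. -/
theorem wOp_radial {N : ℕ} (α : ℝ) (f f₁ f₂ : ℝ → ℝ)
    (hf : ∀ s, 0 < s → HasDerivAt f (f₁ s) s) (hdf : ∀ s, 0 < s → HasDerivAt f₁ (f₂ s) s)
    (u : EuclideanSpace ℝ (Fin N) → ℝ) (hu : ∀ y, y ≠ 0 → u y = f (‖y‖ ^ (2 - α)))
    {x : EuclideanSpace ℝ (Fin N)} (hx : x ≠ 0) :
    wOp α u x = (2 - α) ^ 2 * (‖x‖ ^ (2 - α) * f₂ (‖x‖ ^ (2 - α)))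
      + (2 - α) * N * f₁ (‖x‖ ^ (2 - α)) := by
  have nhds_ne : ∀ y : EuclideanSpace ℝ (Fin N), y ≠ 0 → ∀ᶠ z in nhds y, z ≠ 0 :=
    fun y hy => isOpen_ne.mem_nhds hy
  have hs : ∀ y : EuclideanSpace ℝ (Fin N), y ≠ 0 → 0 < ‖y‖ ^ (2 - α) :=
    fun y hy => Real.rpow_pos_of_pos (norm_pos_iff.2 hy) _
  have fd : ∀ y : EuclideanSpace ℝ (Fin N), y ≠ 0 → ∀ v, fderiv ℝ u y v =
      f₁ (‖y‖ ^ (2 - α)) * ((2 - α) * ‖y‖ ^ (-α) * inner ℝ y v) := by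
    intro y hy v
    have h1 := (hf _ (hs y hy)).comp_hasFDerivAt y (hasFDerivAt_norm_rpow_of_ne_zero (2 - α) hy)
    have h2 : HasFDerivAt u _ y :=
      h1.congr_of_eventuallyEq ((nhds_ne y hy).mono fun z hz => hu z hz)
    rw [h2.fderiv, show (2 - α - 2) = -α by ring]
    simp
  have hr : 0 < ‖x‖ := norm_pos_iff.2 hx
  have sd : ∀ i : Fin N, fderiv ℝ (fun y => fderiv ℝ u y (EuclideanSpace.single i 1)) x
      (EuclideanSpace.single i 1) =
      (f₂ (‖x‖ ^ (2 - α)) * (2 - α) ^ 2 * (‖x‖ ^ (-α)) ^ 2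
        - f₁ (‖x‖ ^ (2 - α)) * (2 - α) * α * ‖x‖ ^ (-α - 2)) * (x i) ^ 2
        + f₁ (‖x‖ ^ (2 - α)) * (2 - α) * ‖x‖ ^ (-α) := by
    intro i
    have h1 := (hdf _ (hs x hx)).comp_hasFDerivAt x (hasFDerivAt_norm_rpow_of_ne_zero (2 - α) hx)
    have h2 := (hasFDerivAt_norm_rpow_of_ne_zero (-α) hx).const_mul (2 - α)
    have h3 : HasFDerivAt (fun y : EuclideanSpace ℝ (Fin N) => y i)
      (EuclideanSpace.proj i : EuclideanSpace ℝ (Fin N) →L[ℝ] ℝ) x :=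
      (EuclideanSpace.proj i : EuclideanSpace ℝ (Fin N) →L[ℝ] ℝ).hasFDerivAt
    have h4 := h1.mul (h2.mul h3)
    have h5 : HasFDerivAt (fun y => fderiv ℝ u y (EuclideanSpace.single i 1)) _ x :=
      h4.congr_of_eventuallyEq ((nhds_ne x hx).mono fun z hz => by
        simp [fd z hz, EuclideanSpace.inner_single_right])
    rw [h5.fderiv, show (2 - α - 2) = -α by ring]
    simp [EuclideanSpace.inner_single_right]
    ring
  have hlap : lap u x = (f₂ (‖x‖ ^ (2 - α)) * (2 - α) ^ 2 * (‖x‖ ^ (-α)) ^ 2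
        - f₁ (‖x‖ ^ (2 - α)) * (2 - α) * α * ‖x‖ ^ (-α - 2)) * ‖x‖ ^ 2
        + N * (f₁ (‖x‖ ^ (2 - α)) * (2 - α) * ‖x‖ ^ (-α)) := by
    rw [lap, Finset.sum_congr rfl fun i _ => sd i, Finset.sum_add_distrib, ← Finset.mul_sum,
      EuclideanSpace.real_norm_sq_eq]
    simp
  have e1 : ‖x‖ ^ (2 - α) = ‖x‖ ^ 2 * (‖x‖ ^ α)⁻¹ := by
    rw [Real.rpow_sub hr, Real.rpow_two, div_eq_mul_inv]
  have e2 : ‖x‖ ^ (-α) = (‖x‖ ^ α)⁻¹ := Real.rpow_neg hr.le _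
  have e3 : ‖x‖ ^ (-α - 2) = (‖x‖ ^ α)⁻¹ / ‖x‖ ^ 2 := by
    rw [Real.rpow_sub hr, e2, Real.rpow_two]
  have e4 : ‖x‖ ^ (α - 2) = ‖x‖ ^ α / ‖x‖ ^ 2 := by
    rw [Real.rpow_sub hr, Real.rpow_two]
  have hA : 0 < ‖x‖ ^ α := Real.rpow_pos_of_pos hr _
  rw [wOp, hlap, fd x hx, real_inner_self_eq_norm_sq, e2, e3, e4]
  generalize f₁ (‖x‖ ^ (2 - α)) = a
  generalize f₂ (‖x‖ ^ (2 - α)) = b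
  rw [e1]
  field_simp
  ring

/-- Derivative of a multiple of a power of `1 + s`. -/
theorem hasDerivAt_const_mul_one_add_rpow (c q : ℝ) {s : ℝ} (hs : 0 < s) :
    HasDerivAt (fun t : ℝ => c * (1 + t) ^ q) (c * q * (1 + s) ^ (q - 1)) s := by
  have h := (((hasDerivAt_id s).const_add 1).rpow_const (p := q)
    (Or.inl (by simp only [id]; positivity))).const_mul c
  exact h.congr_deriv (by simp only [id]; ring)

/-- The weighted operator on a combination of three powers of `1 + |x|^(2-α)`. -/
theorem wOp_three_powers {N : ℕ} (α a b c p q r : ℝ)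
    (u : EuclideanSpace ℝ (Fin N) → ℝ)
    (hu : ∀ y, y ≠ 0 → u y = a * (1 + ‖y‖ ^ (2 - α)) ^ p + b * (1 + ‖y‖ ^ (2 - α)) ^ q
      + c * (1 + ‖y‖ ^ (2 - α)) ^ r)
    {x : EuclideanSpace ℝ (Fin N)} (hx : x ≠ 0) :
    wOp α u x = (2 - α) ^ 2 * (‖x‖ ^ (2 - α) *
        (a * p * (p - 1) * (1 + ‖x‖ ^ (2 - α)) ^ (p - 1 - 1)
          + b * q * (q - 1) * (1 + ‖x‖ ^ (2 - α)) ^ (q - 1 - 1)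
          + c * r * (r - 1) * (1 + ‖x‖ ^ (2 - α)) ^ (r - 1 - 1)))
      + (2 - α) * N * (a * p * (1 + ‖x‖ ^ (2 - α)) ^ (p - 1)
          + b * q * (1 + ‖x‖ ^ (2 - α)) ^ (q - 1) + c * r * (1 + ‖x‖ ^ (2 - α)) ^ (r - 1)) :=
  wOp_radial α
    (fun s => a * (1 + s) ^ p + b * (1 + s) ^ q + c * (1 + s) ^ r)
    (fun s => a * p * (1 + s) ^ (p - 1) + b * q * (1 + s) ^ (q - 1) + c * r * (1 + s) ^ (r - 1))
    (fun s => a * p * (p - 1) * (1 + s) ^ (p - 1 - 1) + b * q * (q - 1) * (1 + s) ^ (q - 1 - 1)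
      + c * r * (r - 1) * (1 + s) ^ (r - 1 - 1))
    (fun _ hs => ((hasDerivAt_const_mul_one_add_rpow _ _ hs).add
      (hasDerivAt_const_mul_one_add_rpow _ _ hs)).add (hasDerivAt_const_mul_one_add_rpow _ _ hs))
    (fun _ hs => ((hasDerivAt_const_mul_one_add_rpow _ _ hs).add
      (hasDerivAt_const_mul_one_add_rpow _ _ hs)).add (hasDerivAt_const_mul_one_add_rpow _ _ hs))
    u hu hx

/-- `Z₀(x) = (1−|x|^{2−α})/(1+|x|^{2−α})^{(N−2+α)/(2−α)}` solves the linearized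
equation `div(|x|^α ∇(div(|x|^α ∇Z₀))) = (2**_α − 1) U_{1,α}^{2**_α−2} Z₀` on `ℝ^N \ {0}`. -/
theorem stmt6 (N : ℕ) (hN : 2 ≤ N) (α : ℝ) (hα1 : ((4 : ℝ) - N)/2 < α) (hα2 : α < 2) :
    let Z₀ : EuclideanSpace ℝ (Fin N) → ℝ :=
      fun x => (1 - ‖x‖ ^ (2-α)) / (1 + ‖x‖ ^ (2-α)) ^ (((N : ℝ) - 2 + α)/(2-α))
    ∀ x : EuclideanSpace ℝ (Fin N), x ≠ 0 →
      wOp α (wOp α Z₀) x = (pexp N α - 1) * (Usol N α 1 x) ^ (pexp N α - 2) * Z₀ x := by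
  intro Z₀ x hx
  have hβ : 0 < 2 - α := by linarith
  have hN2 : (2 : ℝ) ≤ N := by exact_mod_cast hN
  have hM : 0 < (N : ℝ) - 4 + 2 * α := by linarith
  obtain ⟨n, hn⟩ : ∃ n : ℝ, n = N / (2 - α) := ⟨_, rfl⟩
  have hNn : (N : ℝ) = n * (2 - α) := by rw [hn]; field_simp
  have hn2 : 2 < n := by rw [hn, lt_div_iff₀ hβ]; linarith
  have hk : ((N : ℝ) - 2 + α) / (2 - α) = n - 1 := by
    rw [hNn]; field_simp; ring
  have hw : ∀ y : EuclideanSpace ℝ (Fin N), 0 < 1 + ‖y‖ ^ (2 - α) := fun y => by positivity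
  have shift : ∀ {w : ℝ}, 0 < w → ∀ (q : ℝ) (k : ℕ), q = -n - 3 + k →
      w ^ q = w ^ (-n - 3) * w ^ k := by
    intro w h q k hq
    rw [hq, Real.rpow_add h, Real.rpow_natCast]
  have hZ : ∀ y, Z₀ y = 2 * (1 + ‖y‖ ^ (2 - α)) ^ (1 - n)
      + (-1) * (1 + ‖y‖ ^ (2 - α)) ^ (2 - n) + 0 * (1 + ‖y‖ ^ (2 - α)) ^ (0 : ℝ) := by
    intro y
    simp only [Z₀, hk]
    rw [div_eq_mul_inv, ← Real.rpow_neg (hw y).le, neg_sub,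
      shift (hw y) (1 - n) 4 (by push_cast; ring), shift (hw y) (2 - n) 5 (by push_cast; ring)]
    ring
  have hL : ∀ y, y ≠ 0 → wOp α Z₀ y =
      (-2 * n * (n - 1) * (2 - α) ^ 2) * (1 + ‖y‖ ^ (2 - α)) ^ (-n - 1)
      + ((n - 2) * (2 - α) ^ 2) * (1 + ‖y‖ ^ (2 - α)) ^ (1 - n)
      + ((n - 2) * (n - 1) * (2 - α) ^ 2) * (1 + ‖y‖ ^ (2 - α)) ^ (-n) := by
    intro y hy
    rw [wOp_three_powers α _ _ _ _ _ _ Z₀ (fun y _ => hZ y) hy, hNn,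
      shift (hw y) (1 - n - 1 - 1) 2 (by push_cast; ring),
      shift (hw y) (2 - n - 1 - 1) 3 (by push_cast; ring),
      shift (hw y) (1 - n - 1) 3 (by push_cast; ring),
      shift (hw y) (2 - n - 1) 4 (by push_cast; ring),
      shift (hw y) (-n - 1) 2 (by push_cast; ring),
      shift (hw y) (1 - n) 4 (by push_cast; ring),
      shift (hw y) (-n) 3 (by push_cast; ring)]
    ring
  have hP : 0 < ((N : ℝ) - 4 + 2 * α) * ((N : ℝ) - 2 + α) * N * ((N : ℝ) + 2 - α) :=
    mul_pos (mul_pos (mul_pos hM (by linarith)) (by linarith)) (by linarith)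
  have hpe : pexp N α - 2 = (8 - 4 * α) / ((N : ℝ) - 4 + 2 * α) := by
    rw [pexp]; field_simp; ring
  have hp1 : pexp N α - 1 = (n + 2) / (n - 2) := by
    have : n - 2 ≠ 0 := by linarith
    rw [pexp, show (N : ℝ) - 4 + 2 * α = (n - 2) * (2 - α) by rw [hNn]; ring, hNn]
    field_simp; ring
  have h84 : 0 < 8 - 4 * α := by linarith
  have hU : Usol N α 1 x ^ (pexp N α - 2) =
      ((N : ℝ) - 4 + 2 * α) * ((N : ℝ) - 2 + α) * N * ((N : ℝ) + 2 - α) *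
        ((1 + ‖x‖ ^ (2 - α)) ^ 4)⁻¹ := by
    rw [Usol, Cconst, Real.one_rpow, Real.one_rpow, mul_one, one_mul, hpe,
      Real.mul_rpow (Real.rpow_nonneg hP.le _) (Real.rpow_nonneg (hw x).le _),
      ← Real.rpow_mul hP.le, ← Real.rpow_mul (hw x).le]
    congr 1
    · convert Real.rpow_one _ using 2
      field_simp
    · rw [show -(((N : ℝ) - 4 + 2 * α) / (2 - α)) * ((8 - 4 * α) / ((N : ℝ) - 4 + 2 * α))
        = -((4 : ℕ) : ℝ) by push_cast; field_simp; ring, Real.rpow_neg (hw x).le,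
        Real.rpow_natCast]
  rw [wOp_three_powers α _ _ _ _ _ _ (wOp α Z₀) hL hx, hU, hp1, hZ x, hNn,
    shift (hw x) (-n - 1 - 1 - 1) 0 (by push_cast; ring),
    shift (hw x) (-n - 1 - 1) 1 (by push_cast; ring),
    shift (hw x) (1 - n - 1 - 1) 2 (by push_cast; ring),
    shift (hw x) (1 - n - 1) 3 (by push_cast; ring),
    shift (hw x) (-n - 1) 2 (by push_cast; ring),
    shift (hw x) (1 - n) 4 (by push_cast; ring),
    shift (hw x) (2 - n) 5 (by push_cast; ring)]
  have hw0 := (hw x).ne'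
  have hn20 : n - 2 ≠ 0 := by linarith
  obtain ⟨w, hwx⟩ : ∃ w, w = 1 + ‖x‖ ^ (2 - α) := ⟨_, rfl⟩
  rw [← hwx] at hw0 ⊢
  rw [show ‖x‖ ^ (2 - α) = w - 1 by rw [hwx]; ring]
  field_simp
  ring

end
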